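/- arXiv:2511.06007 — 4 statements merged into one kernel-verified Lean document; each statement's English description precedes it below -/
import Mathlib

section
/- Let T > 0 and let u : ℝ × ℝ → ℝ (written u(x,t)) be smooth, satisfy ∂_t u(x,t) = ∂_x^5 u(x,t) for all x ≤ 0 and all t ∈ [0,T], and have left-decay of order 5 on [0,T]. Then the function E(t) = ∫_{-∞}^0 u(x,t)^2 dx is differentiable on [0,T] and for every t ∈ [0,T], E'(t) = (∂_x^2 u(0,t))^2 + 2 u(0,t) ∂_x^4 u(0,t) − 2 ∂_x u(0,t) ∂_x^3 u(0,t). -/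
open MeasureTheory Set

/-- `k`-th partial derivative in the first (space) variable of `w : ℝ × ℝ → ℝ`. -/
noncomputable def pdx (k : ℕ) (w : ℝ × ℝ → ℝ) (x t : ℝ) : ℝ :=
  iteratedDeriv k (fun y => w (y, t)) x

/-- Partial derivative in the second (time) variable of `w : ℝ × ℝ → ℝ`. -/
noncomputable def pdt (w : ℝ × ℝ → ℝ) (x t : ℝ) : ℝ :=
  deriv (fun s => w (x, s)) t

/-- `w` has left-decay of order 5 on `[0,T]`. -/
def LeftDecay5 (w : ℝ × ℝ → ℝ) (T : ℝ) : Prop :=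
  ∃ C > (0:ℝ), ∀ k ≤ 5, ∀ t ∈ Icc (0:ℝ) T, ∀ x ≤ (0:ℝ),
    |pdx k w x t| ≤ C * (1 + x ^ 2)⁻¹

/-- Differentiation under the integral sign, relative to a convex set of parameters. -/
theorem hasDerivWithinAt_integral_of_dominated_of_convex {α : Type*} [MeasurableSpace α]
    {μ : Measure α} {F F' : ℝ → α → ℝ} {S : Set ℝ} {bound : α → ℝ} {t : ℝ}
    (hS : Convex ℝ S) (ht : t ∈ S) (hF_int : ∀ s ∈ S, Integrable (F s) μ)
    (h_bound : ∀ᵐ a ∂μ, ∀ s ∈ S, ‖F' s a‖ ≤ bound a) (bound_int : Integrable bound μ)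
    (h_diff : ∀ᵐ a ∂μ, ∀ s ∈ S, HasDerivWithinAt (fun r => F r a) (F' s a) S s) :
    HasDerivWithinAt (fun s => ∫ a, F s a ∂μ) (∫ a, F' t a ∂μ) S t := by
  rw [hasDerivWithinAt_iff_tendsto_slope]
  have hmem : ∀ᶠ s in nhdsWithin t (S \ {t}), s ∈ S \ {t} := self_mem_nhdsWithin
  have hlim : Filter.Tendsto (fun s => ∫ a, slope (fun r => F r a) t s ∂μ)
      (nhdsWithin t (S \ {t})) (nhds (∫ a, F' t a ∂μ)) := by
    refine tendsto_integral_filter_of_dominated_convergence bound ?_ ?_ bound_int ?_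
    · filter_upwards [hmem] with s hs
      simp only [slope_def_module]
      exact (((hF_int s hs.1).sub (hF_int t ht)).smul (s - t)⁻¹).aestronglyMeasurable
    · filter_upwards [hmem] with s hs
      filter_upwards [h_bound, h_diff] with a hb hd
      have hle := hS.norm_image_sub_le_of_norm_hasDerivWithin_le hd hb ht hs.1
      have hne : 0 < ‖s - t‖ := norm_pos_iff.mpr (sub_ne_zero.mpr hs.2)
      rw [slope_def_field, norm_div]
      exact (div_le_iff₀ hne).mpr hle
    · filter_upwards [h_diff] with a hd
      exact hasDerivWithinAt_iff_tendsto_slope.mp (hd t ht)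
  refine hlim.congr' ?_
  filter_upwards [hmem] with s hs
  simp only [slope_def_module]
  rw [integral_smul, integral_sub (hF_int s hs.1) (hF_int t ht)]

theorem pdx_zero (w : ℝ × ℝ → ℝ) (x t : ℝ) : pdx 0 w x t = w (x, t) := by
  simp [pdx]

theorem contDiff_slice_left {w : ℝ × ℝ → ℝ} (hw : ContDiff ℝ (⊤ : ℕ∞) w) (t : ℝ) :
    ContDiff ℝ (⊤ : ℕ∞) (fun y => w (y, t)) :=
  hw.comp (contDiff_id.prodMk contDiff_const)

theorem hasDerivAt_pdx {w : ℝ × ℝ → ℝ} (hw : ContDiff ℝ (⊤ : ℕ∞) w) (k : ℕ) (x t : ℝ) :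
    HasDerivAt (fun y => pdx k w y t) (pdx (k + 1) w x t) x := by
  have hd : Differentiable ℝ (iteratedDeriv k (fun y => w (y, t))) :=
    (contDiff_slice_left hw t).differentiable_iteratedDeriv k
      (by exact_mod_cast WithTop.coe_lt_top k)
  simpa only [pdx, iteratedDeriv_succ] using (hd x).hasDerivAt

theorem continuous_pdx {w : ℝ × ℝ → ℝ} (hw : ContDiff ℝ (⊤ : ℕ∞) w) (k : ℕ) (t : ℝ) :
    Continuous (fun y => pdx k w y t) :=
  continuous_iff_continuousAt.mpr fun x => (hasDerivAt_pdx hw k x t).continuousAt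

theorem hasDerivAt_pdt {w : ℝ × ℝ → ℝ} (hw : ContDiff ℝ (⊤ : ℕ∞) w) (x t : ℝ) :
    HasDerivAt (fun s => w (x, s)) (pdt w x t) t := by
  have h : ContDiff ℝ (⊤ : ℕ∞) (fun s => w (x, s)) :=
    hw.comp (contDiff_const.prodMk contDiff_id)
  exact (h.differentiable (by simp) t).hasDerivAt

theorem abs_mul_le_sq_mul_inv_one_add_sq {a b C x : ℝ}
    (ha : |a| ≤ C * (1 + x ^ 2)⁻¹) (hb : |b| ≤ C * (1 + x ^ 2)⁻¹) :
    |a * b| ≤ C ^ 2 * (1 + x ^ 2)⁻¹ := by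
  have h1 : (1 + x ^ 2)⁻¹ ≤ 1 := inv_le_one_of_one_le₀ (by nlinarith [sq_nonneg x])
  have h0 : 0 ≤ (1 + x ^ 2)⁻¹ := by positivity
  calc |a * b| = |a| * |b| := abs_mul a b
    _ ≤ (C * (1 + x ^ 2)⁻¹) * (C * (1 + x ^ 2)⁻¹) :=
      mul_le_mul ha hb (abs_nonneg b) ((abs_nonneg a).trans ha)
    _ = C ^ 2 * ((1 + x ^ 2)⁻¹ * (1 + x ^ 2)⁻¹) := by ring
    _ ≤ C ^ 2 * (1 + x ^ 2)⁻¹ :=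
      mul_le_mul_of_nonneg_left (mul_le_of_le_one_left h0 h1) (sq_nonneg C)

theorem tendsto_const_mul_inv_one_add_sq_atBot (c : ℝ) :
    Filter.Tendsto (fun x : ℝ => c * (1 + x ^ 2)⁻¹) Filter.atBot (nhds 0) := by
  have h : Filter.Tendsto (fun x : ℝ => 1 + x ^ 2) Filter.atBot Filter.atTop :=
    Filter.tendsto_atTop_add_const_left _ _
      (Filter.Tendsto.congr (fun x => by simp)
        ((Filter.tendsto_pow_atTop two_ne_zero).comp Filter.tendsto_abs_atBot_atTop))
  simpa using h.inv_tendsto_atTop.const_mul c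

/-- Boundary energy identity for the linearized Kawahara equation
`∂ₜ u = ∂ₓ⁵ u` on the left half-line `(-∞, 0)`. -/
theorem kawahara_left_energy_identity
    (T : ℝ) (hT : 0 < T) (u : ℝ × ℝ → ℝ)
    (hsmooth : ContDiff ℝ (⊤ : ℕ∞) u)
    (heq : ∀ x ≤ (0:ℝ), ∀ t ∈ Icc (0:ℝ) T, pdt u x t = pdx 5 u x t)
    (hdecay : LeftDecay5 u T) :
    ∀ t ∈ Icc (0:ℝ) T,
      HasDerivWithinAt (fun s => ∫ x in Iic (0:ℝ), (u (x, s)) ^ 2)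
        ((pdx 2 u 0 t) ^ 2 + 2 * u (0, t) * pdx 4 u 0 t
          - 2 * pdx 1 u 0 t * pdx 3 u 0 t) (Icc (0:ℝ) T) t := by
  obtain ⟨C, -, hC⟩ := hdecay
  intro t ht
  have hprod : ∀ i ≤ 5, ∀ j ≤ 5, ∀ s ∈ Icc (0:ℝ) T, ∀ x ≤ (0:ℝ),
      |pdx i u x s * pdx j u x s| ≤ C ^ 2 * (1 + x ^ 2)⁻¹ := fun i hi j hj s hs x hx =>
    abs_mul_le_sq_mul_inv_one_add_sq (hC i hi s hs x hx) (hC j hj s hs x hx)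
  have hbound : IntegrableOn (fun x : ℝ => C ^ 2 * (1 + x ^ 2)⁻¹) (Iic 0) :=
    (integrable_inv_one_add_sq.const_mul _).integrableOn
  have hint : ∀ i ≤ 5, ∀ j ≤ 5, ∀ s ∈ Icc (0:ℝ) T,
      IntegrableOn (fun x => pdx i u x s * pdx j u x s) (Iic 0) := by
    intro i hi j hj s hs
    refine Integrable.mono' hbound
      ((continuous_pdx hsmooth i s).mul (continuous_pdx hsmooth j s)).aestronglyMeasurable ?_
    exact ae_restrict_of_forall_mem measurableSet_Iic fun x hx => hprod i hi j hj s hs x hx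
  have htend : ∀ i ≤ 5, ∀ j ≤ 5,
      Filter.Tendsto (fun x => pdx i u x t * pdx j u x t) Filter.atBot (nhds 0) := by
    intro i hi j hj
    refine squeeze_zero_norm' ?_ (tendsto_const_mul_inv_one_add_sq_atBot (C ^ 2))
    filter_upwards [Filter.eventually_le_atBot (0:ℝ)] with x hx
    exact hprod i hi j hj t ht x hx
  have hflux : ∫ x in Iic (0:ℝ), 2 * (pdx 0 u x t * pdx 5 u x t)
      = (pdx 2 u 0 t) ^ 2 + 2 * u (0, t) * pdx 4 u 0 t - 2 * pdx 1 u 0 t * pdx 3 u 0 t := by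
    have hd := fun k x => hasDerivAt_pdx hsmooth k x t
    rw [integral_Iic_of_hasDerivAt_of_tendsto' (m := 0)
      (f := fun x => pdx 2 u x t * pdx 2 u x t + 2 * (pdx 0 u x t * pdx 4 u x t)
        - 2 * (pdx 1 u x t * pdx 3 u x t))]
    · simp only [pdx_zero]
      ring
    · intro x _
      refine ((((hd 2 x).mul (hd 2 x)).add (((hd 0 x).mul (hd 4 x)).const_mul 2)).sub
        (((hd 1 x).mul (hd 3 x)).const_mul 2)).congr_deriv ?_
      ring
    · exact (hint 0 (by norm_num) 5 le_rfl t ht).const_mul 2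
    · simpa using ((htend 2 (by norm_num) 2 (by norm_num)).add
        ((htend 0 (by norm_num) 4 (by norm_num)).const_mul 2)).sub
        ((htend 1 (by norm_num) 3 (by norm_num)).const_mul 2)
  rw [← hflux]
  refine hasDerivWithinAt_integral_of_dominated_of_convex
    (F' := fun s x => 2 * (pdx 0 u x s * pdx 5 u x s)) (convex_Icc 0 T) ht ?_ ?_
    (hbound.const_mul 2) ?_
  · intro s hs
    simpa only [pdx_zero, ← sq, IntegrableOn] using hint 0 (by norm_num) 0 (by norm_num) s hs
  · refine ae_restrict_of_forall_mem measurableSet_Iic fun x hx s hs => ?_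
    rw [norm_mul, Real.norm_two]
    exact mul_le_mul_of_nonneg_left (hprod 0 (by norm_num) 5 le_rfl s hs x hx) zero_le_two
  · refine ae_restrict_of_forall_mem measurableSet_Iic fun x hx s hs => ?_
    refine (((hasDerivAt_pdt hsmooth x s).pow 2).congr_deriv ?_).hasDerivWithinAt
    rw [heq x hx s hs, pdx_zero]
    ring
end

section
/- For every real number x, the improper oscillatory integral defining the fundamental oscillatory function of the linearized Kawahara equation converges: there exists L ∈ ℂ such that the function R ↦ ∫_{−R}^{R} exp(i(xξ + ξ^5)) dξ tends to L as R → ∞. -/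
open MeasureTheory intervalIntegral Filter

/-- An integrand that differs by an integrable function from the derivative of a function
vanishing at `±∞` has convergent symmetric integrals. -/
theorem exists_tendsto_symm_intervalIntegral {f r G : ℝ → ℂ} (hf : Continuous f)
    (hrc : Continuous r) (hr : Integrable r) (hG : ∀ t, HasDerivAt G (f t - r t) t)
    (htop : Tendsto G atTop (nhds 0)) (hbot : Tendsto G atBot (nhds 0)) :
    ∃ L : ℂ, Tendsto (fun R : ℝ => ∫ t in (-R)..R, f t) atTop (nhds L) := by
  refine ⟨0 - 0 + ∫ t, r t, Tendsto.congr (fun R => ?_)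
    ((htop.sub (hbot.comp tendsto_neg_atTop_atBot)).add
      (intervalIntegral_tendsto_integral hr tendsto_neg_atTop_atBot tendsto_id))⟩
  have h := integral_eq_sub_of_hasDerivAt (a := -R) (b := R) (fun t _ => hG t)
    ((hf.sub hrc).intervalIntegrable _ _)
  rw [integral_sub (hf.intervalIntegrable _ _) (hrc.intervalIntegrable _ _)] at h
  simp only [Function.comp, id]
  rw [← h]
  ring

/-- The derivative of `1 / (5 t ^ 4 + 5)`. -/
theorem hasDerivAt_inv_five_mul_pow_four_add_five (t : ℝ) :
    HasDerivAt (fun s : ℝ => (5 * s ^ 4 + 5)⁻¹) (-(20 * t ^ 3) / (5 * t ^ 4 + 5) ^ 2) t := by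
  have h : HasDerivAt (fun s : ℝ => 5 * s ^ 4 + 5) (20 * t ^ 3) t :=
    (((hasDerivAt_pow 4 t).const_mul 5).add_const 5).congr_deriv (by norm_num; ring)
  exact h.fun_inv (by positivity)

theorem inv_five_mul_pow_four_add_five_le (t : ℝ) :
    (5 * t ^ 4 + 5)⁻¹ ≤ (1 + t ^ 2)⁻¹ := by
  apply inv_anti₀ (by positivity)
  nlinarith [sq_nonneg (t ^ 2 - 1)]

theorem abs_deriv_inv_five_mul_pow_four_add_five_le (t : ℝ) :
    |-(20 * t ^ 3) / (5 * t ^ 4 + 5) ^ 2| ≤ (1 + t ^ 2)⁻¹ := by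
  rw [abs_div, abs_neg, abs_of_pos (by positivity : (0 : ℝ) < (5 * t ^ 4 + 5) ^ 2),
    div_le_iff₀ (by positivity), ← div_eq_inv_mul, le_div_iff₀ (by positivity)]
  have h3 : |20 * t ^ 3| ≤ 10 * (t ^ 2 + t ^ 4) := by
    rw [abs_le]
    constructor <;> nlinarith [sq_nonneg (t * (t + 1)), sq_nonneg (t * (t - 1))]
  have h2 : 2 * t ^ 2 ≤ 1 + t ^ 4 := by nlinarith [sq_nonneg (t ^ 2 - 1)]
  calc |20 * t ^ 3| * (1 + t ^ 2)
      ≤ (10 * (t ^ 2 + t ^ 4)) * (1 + t ^ 2) := by gcongr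
    _ ≤ (5 * t ^ 4 + 5) ^ 2 := by
      nlinarith [mul_nonneg (sq_nonneg t) (sub_nonneg.2 h2), sq_nonneg (t ^ 4),
        mul_nonneg (by positivity : 0 ≤ 1 + t ^ 4) (sub_nonneg.2 h2), sq_nonneg (t ^ 4 - 1)]

/-- Convergence of the improper oscillatory integral defining the fundamental
oscillatory kernel `B(x) = (1/2π) ∫_ℝ e^{i(xξ + ξ⁵)} dξ` of the linearized
Kawahara equation. -/
theorem kawahara_oscillatory_integral_converges (x : ℝ) :
    ∃ L : ℂ, Tendsto
      (fun R : ℝ => ∫ ξ in (-R)..R,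
        Complex.exp (Complex.I * ((x * ξ + ξ ^ 5 : ℝ) : ℂ)))
      atTop (nhds L) := by
  set E : ℝ → ℂ := fun t => Complex.exp (Complex.I * ((x * t + t ^ 5 : ℝ) : ℂ)) with hE
  set w : ℝ → ℝ := fun t => (5 * t ^ 4 + 5)⁻¹ with hw
  set w' : ℝ → ℝ := fun t => -(20 * t ^ 3) / (5 * t ^ 4 + 5) ^ 2
  have hE_norm (t : ℝ) : ‖E t‖ = 1 := by
    simp only [hE, mul_comm Complex.I, Complex.norm_exp_ofReal_mul_I]
  have hEc : Continuous E := by fun_prop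
  have hwc : Continuous w := by
    refine Continuous.inv₀ (by fun_prop) fun t => by positivity
  have hwc' : Continuous w' := by
    refine Continuous.div (by fun_prop) (by fun_prop) fun t => by positivity
  have hw_pos (t : ℝ) : 0 < w t := by simp only [hw]; positivity
  have hE_deriv (t : ℝ) : HasDerivAt E (E t * (Complex.I * ((x + 5 * t ^ 4 : ℝ) : ℂ))) t := by
    have h : HasDerivAt (fun s : ℝ => x * s + s ^ 5) (x + 5 * t ^ 4) t :=
      (((hasDerivAt_id t).const_mul x).add (hasDerivAt_pow 5 t)).congr_deriv (by norm_num)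
    exact (h.ofReal_comp.const_mul Complex.I).cexp
  have hrc : Continuous fun t => E t * ((5 - x : ℝ) * (w t : ℂ) + Complex.I * (w' t : ℂ)) := by
    fun_prop
  have hG_norm (t : ℝ) : ‖-Complex.I * (E t * (w t : ℂ))‖ ≤ (1 + t ^ 2)⁻¹ := by
    simpa [hE_norm, abs_of_pos (hw_pos t)] using inv_five_mul_pow_four_add_five_le t
  have hlim {l : Filter ℝ} (hl : Tendsto (fun t : ℝ => t ^ 2) l atTop) :
      Tendsto (fun t => -Complex.I * (E t * (w t : ℂ))) l (nhds 0) :=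
    squeeze_zero_norm hG_norm
      (tendsto_inv_atTop_zero.comp (tendsto_atTop_add_const_left _ 1 hl))
  refine exists_tendsto_symm_intervalIntegral
    (G := fun t => -Complex.I * (E t * (w t : ℂ))) hEc hrc ?_ (fun t => ?_)
    (hlim (tendsto_pow_atTop two_ne_zero))
    (hlim ((tendsto_pow_atTop two_ne_zero).comp tendsto_neg_atBot_atTop |>.congr
      fun t => by simp))
  · refine (integrable_inv_one_add_sq.const_mul (|5 - x| + 1)).mono'
      hrc.aestronglyMeasurable (Eventually.of_forall fun t => ?_)
    rw [norm_mul, hE_norm, one_mul, add_mul, one_mul]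
    refine (norm_add_le _ _).trans (add_le_add ?_ ?_)
    · rw [norm_mul, Complex.norm_real, Complex.norm_real, Real.norm_eq_abs, Real.norm_eq_abs,
        abs_of_pos (hw_pos t)]
      exact mul_le_mul_of_nonneg_left (inv_five_mul_pow_four_add_five_le t) (abs_nonneg _)
    · rw [norm_mul, Complex.norm_I, one_mul, Complex.norm_real, Real.norm_eq_abs]
      exact abs_deriv_inv_five_mul_pow_four_add_five_le t
  · have hmul : ((x + 5 * t ^ 4 : ℝ) : ℂ) * (w t : ℂ) = 1 - (5 - x : ℝ) * (w t : ℂ) := by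
      have h : (x + 5 * t ^ 4) * w t = 1 - (5 - x) * w t := by
        have : (5 * t ^ 4 + 5) * w t = 1 := mul_inv_cancel₀ (by positivity)
        linarith
      exact_mod_cast h
    refine (((hE_deriv t).mul
      (hasDerivAt_inv_five_mul_pow_four_add_five t).ofReal_comp).const_mul
        (-Complex.I)).congr_deriv ?_
    symm
    change _ = -Complex.I * (E t * (Complex.I * ((x + 5 * t ^ 4 : ℝ) : ℂ)) * (w t : ℂ) +
      E t * (w' t : ℂ))
    linear_combination (-E t) * hmul +
      (E t * ((x + 5 * t ^ 4 : ℝ) : ℂ) * (w t : ℂ)) * Complex.I_mul_I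
end

section
/- Let α > 0 and β > 0, and let f : ℝ → ℝ be continuous with f(s) = 0 for all s ≤ 0. Then for every t ∈ ℝ, I_α(I_β f)(t) = I_{α+β} f(t); explicitly, (1/Γ(α)) ∫_0^t (t−s)^{α−1} [ (1/Γ(β)) ∫_0^s (s−r)^{β−1} f(r) dr ] ds = (1/Γ(α+β)) ∫_0^t (t−s)^{α+β−1} f(s) ds. -/
open MeasureTheory intervalIntegral Real

/-- The Euler beta integral over the interval `[r, t]`. -/
theorem integral_rpow_mul_rpow {α β r t : ℝ} (hα : 0 < α) (hβ : 0 < β) (hrt : r < t) :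
    ∫ s in r..t, (t - s) ^ (α - 1) * (s - r) ^ (β - 1) =
      Gamma α * Gamma β / Gamma (α + β) * (t - r) ^ (α + β - 1) := by
  have ha : 0 < t - r := sub_pos.2 hrt
  have h := Complex.betaIntegral_scaled (β : ℂ) (α : ℂ) ha
  rw [Complex.betaIntegral_eq_Gamma_mul_div _ _ (by simpa using hβ) (by simpa using hα)] at h
  have hshift : ∫ s in r..t, (t - s) ^ (α - 1) * (s - r) ^ (β - 1) =
      ∫ x in (0:ℝ)..(t - r), x ^ (β - 1) * ((t - r) - x) ^ (α - 1) := by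
    have := intervalIntegral.integral_comp_sub_right (a := r) (b := t)
      (fun x : ℝ => x ^ (β - 1) * ((t - r) - x) ^ (α - 1)) r
    rw [sub_self] at this
    rw [← this]
    refine intervalIntegral.integral_congr fun s _ => ?_
    simp only [sub_sub_sub_cancel_right]
    ring
  rw [hshift]
  apply Complex.ofReal_injective
  rw [← intervalIntegral.integral_ofReal]
  push_cast [← Complex.Gamma_ofReal, Complex.ofReal_cpow ha.le]
  rw [add_comm (α : ℂ) β, mul_comm (Complex.Gamma α), mul_comm (_ / _)]
  push_cast at h
  rw [← h]
  refine intervalIntegral.integral_congr fun x hx => ?_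
  rw [Set.uIcc_of_le ha.le] at hx
  simp only [Complex.ofReal_cpow hx.1, Complex.ofReal_cpow (sub_nonneg.2 hx.2)]
  push_cast
  rfl

theorem intervalIntegrable_rpow_mul_rpow {α β r t : ℝ} (hα : 0 < α) (hβ : 0 < β) (hrt : r < t) :
    IntervalIntegrable (fun s => (t - s) ^ (α - 1) * (s - r) ^ (β - 1)) volume r t := by
  apply intervalIntegrable_of_integral_ne_zero
  rw [integral_rpow_mul_rpow hα hβ hrt]
  have := Gamma_pos_of_pos hα
  have := Gamma_pos_of_pos hβ
  have := Gamma_pos_of_pos (add_pos hα hβ)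
  have := rpow_pos_of_pos (sub_pos.2 hrt) (α + β - 1)
  positivity

theorem intervalIntegrable_sub_rpow_mul {γ t : ℝ} (hγ : 0 < γ) {f : ℝ → ℝ} (hf : Continuous f) :
    IntervalIntegrable (fun s => (t - s) ^ (γ - 1) * f s) volume 0 t := by
  refine IntervalIntegrable.mul_continuousOn ?_ hf.continuousOn
  have := (intervalIntegrable_rpow' (a := t) (b := 0) (r := γ - 1) (by linarith)).comp_sub_left t
  simpa using this

/-- Fubini's theorem on the triangle `0 < r < s < t` for the kernels of two
Riemann–Liouville integrals. -/
theorem integral_rpow_mul_integral_rpow_mul {α β t : ℝ} (hα : 0 < α) (hβ : 0 < β) (ht : 0 < t)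
    {f : ℝ → ℝ} (hf : Continuous f) :
    ∫ s in (0:ℝ)..t, (t - s) ^ (α - 1) * ∫ r in (0:ℝ)..s, (s - r) ^ (β - 1) * f r =
      Gamma α * Gamma β / Gamma (α + β) * ∫ r in (0:ℝ)..t, (t - r) ^ (α + β - 1) * f r := by
  let μ : Measure ℝ := volume.restrict (Set.Ioo 0 t)
  let k : ℝ → ℝ → ℝ := fun r => (Set.Ioi r).indicator
    fun s => (t - s) ^ (α - 1) * (s - r) ^ (β - 1)
  have hmeas : Measurable fun p : ℝ × ℝ => k p.2 p.1 := by
    have : (fun p : ℝ × ℝ => k p.2 p.1) = {p : ℝ × ℝ | p.2 < p.1}.indicator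
        fun p => (t - p.1) ^ (α - 1) * (p.1 - p.2) ^ (β - 1) := by
      ext p
      simp [k, Set.indicator]
    rw [this]
    exact Measurable.indicator (by fun_prop) (measurableSet_lt measurable_snd measurable_fst)
  have hrestrict : ∀ r ∈ Set.Ioo 0 t, μ.restrict (Set.Ioi r) = volume.restrict (Set.Ioo r t) := by
    intro r hr
    rw [Measure.restrict_restrict measurableSet_Ioi]
    congr 1
    ext s
    simp only [Set.mem_inter_iff, Set.mem_Ioi, Set.mem_Ioo]
    exact ⟨fun h => ⟨h.1, h.2.2⟩, fun h => ⟨h.1, hr.1.trans h.1, h.2⟩⟩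
  have hk_int : ∀ r ∈ Set.Ioo 0 t, Integrable (k r) μ := by
    intro r hr
    rw [integrable_indicator_iff measurableSet_Ioi, IntegrableOn, hrestrict r hr]
    exact (intervalIntegrable_iff_integrableOn_Ioo_of_le hr.2.le).1
      (intervalIntegrable_rpow_mul_rpow hα hβ hr.2)
  have hk_val : ∀ r ∈ Set.Ioo 0 t, ∫ s, k r s ∂μ =
      Gamma α * Gamma β / Gamma (α + β) * (t - r) ^ (α + β - 1) := by
    intro r hr
    rw [MeasureTheory.integral_indicator measurableSet_Ioi, hrestrict r hr,
      ← integral_Ioc_eq_integral_Ioo, ← intervalIntegral.integral_of_le hr.2.le,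
      integral_rpow_mul_rpow hα hβ hr.2]
  have hk_nonneg : ∀ r, ∀ s ∈ Set.Ioo 0 t, 0 ≤ k r s := by
    intro r s hs
    refine Set.indicator_apply_nonneg fun hrs => ?_
    exact mul_nonneg (rpow_nonneg (sub_nonneg.2 hs.2.le) _)
      (rpow_nonneg (sub_nonneg.2 (le_of_lt hrs)) _)
  have hint : Integrable (Function.uncurry fun s r => k r s * f r) (μ.prod μ) := by
    rw [integrable_prod_iff' (by
      exact (hmeas.mul (hf.measurable.comp measurable_snd)).aestronglyMeasurable)]
    refine ⟨?_, ?_⟩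
    · filter_upwards [ae_restrict_mem measurableSet_Ioo] with r hr
      exact (hk_int r hr).mul_const (f r)
    · have hi := (intervalIntegrable_iff_integrableOn_Ioo_of_le ht.le).1
        (intervalIntegrable_sub_rpow_mul (t := t) (add_pos hα hβ) hf.abs)
      refine (hi.const_mul (Gamma α * Gamma β / Gamma (α + β))).congr ?_
      filter_upwards [ae_restrict_mem measurableSet_Ioo] with r hr
      rw [← mul_assoc, ← hk_val r hr, ← MeasureTheory.integral_mul_const]
      refine setIntegral_congr_fun measurableSet_Ioo fun s hs => ?_
      simp only [Function.uncurry, norm_mul, norm_eq_abs, abs_of_nonneg (hk_nonneg r s hs)]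
  have hswap := integral_integral_swap hint
  have hleft : ∫ s in (0:ℝ)..t, (t - s) ^ (α - 1) * ∫ r in (0:ℝ)..s, (s - r) ^ (β - 1) * f r =
      ∫ s, ∫ r, k r s * f r ∂μ ∂μ := by
    rw [intervalIntegral.integral_of_le ht.le, integral_Ioc_eq_integral_Ioo]
    refine setIntegral_congr_fun measurableSet_Ioo fun s hs => ?_
    have hpt : (fun r => k r s * f r) = (Set.Iio s).indicator
        fun r => (t - s) ^ (α - 1) * ((s - r) ^ (β - 1) * f r) := by
      ext r
      by_cases hrs : r < s <;> simp [k, hrs, mul_assoc]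
    have hset : Set.Iio s ∩ Set.Ioo 0 t = Set.Ioo 0 s := by
      ext r
      simp only [Set.mem_inter_iff, Set.mem_Iio, Set.mem_Ioo]
      exact ⟨fun h => ⟨h.2.1, h.1⟩, fun h => ⟨h.2, h.1, h.2.trans hs.2⟩⟩
    simp only [hpt]
    rw [MeasureTheory.integral_indicator measurableSet_Iio,
      Measure.restrict_restrict measurableSet_Iio, hset, MeasureTheory.integral_const_mul,
      intervalIntegral.integral_of_le hs.1.le, integral_Ioc_eq_integral_Ioo]
  rw [hleft, hswap, intervalIntegral.integral_of_le ht.le, integral_Ioc_eq_integral_Ioo,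
    ← MeasureTheory.integral_const_mul]
  refine setIntegral_congr_fun measurableSet_Ioo fun r hr => ?_
  simp only [MeasureTheory.integral_mul_const, hk_val r hr, mul_assoc]

theorem intervalIntegral_mul_eq_zero_of_nonpos {f : ℝ → ℝ} (hf0 : ∀ s ≤ (0:ℝ), f s = 0)
    (g : ℝ → ℝ) {t : ℝ} (ht : t ≤ 0) : ∫ s in (0:ℝ)..t, g s * f s = 0 := by
  rw [intervalIntegral.integral_congr (g := fun _ => (0:ℝ)), intervalIntegral.integral_zero]
  intro s hs
  rw [Set.uIcc_of_ge ht] at hs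
  simp [hf0 s hs.2]

/-- Semigroup property `I_α ∘ I_β = I_{α+β}` of the Riemann–Liouville
fractional integral, for continuous `f` vanishing on `(-∞, 0]`. -/
theorem riemannLiouville_semigroup (α β : ℝ) (hα : 0 < α) (hβ : 0 < β)
    (f : ℝ → ℝ) (hf : Continuous f) (hf0 : ∀ s ≤ (0:ℝ), f s = 0) :
    ∀ t : ℝ,
      (Real.Gamma α)⁻¹ * ∫ s in (0:ℝ)..t, (t - s) ^ (α - 1) *
          ((Real.Gamma β)⁻¹ * ∫ r in (0:ℝ)..s, (s - r) ^ (β - 1) * f r)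
        = (Real.Gamma (α + β))⁻¹ * ∫ s in (0:ℝ)..t, (t - s) ^ (α + β - 1) * f s := by
  intro t
  rcases le_or_gt t 0 with ht | ht
  · rw [intervalIntegral_mul_eq_zero_of_nonpos hf0 _ ht,
      intervalIntegral_mul_eq_zero_of_nonpos (fun s hs => ?_) _ ht, mul_zero, mul_zero]
    rw [intervalIntegral_mul_eq_zero_of_nonpos hf0 _ hs, mul_zero]
  · simp only [mul_left_comm _ (Real.Gamma β)⁻¹, intervalIntegral.integral_const_mul]
    rw [integral_rpow_mul_integral_rpow_mul hα hβ ht hf]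
    have := (Gamma_pos_of_pos hα).ne'
    have := (Gamma_pos_of_pos hβ).ne'
    field_simp
end

section
/- Let w : ℝ × ℝ → ℂ (written w(x,t)) be a Schwartz function of the two variables (x,t), and define Dw(x,t) = ∫_0^t (1/2π) ∫_ℝ e^{i(xξ + (t−t')ξ^5)} ŵ(ξ,t') dξ dt', where ŵ(ξ,t') = ∫_ℝ e^{−iyξ} w(y,t') dy is the Fourier transform in the space variable. Then Dw is smooth on ℝ × ℝ, satisfies ∂_t Dw(x,t) − ∂_x^5 Dw(x,t) = w(x,t) for all (x,t) ∈ ℝ × ℝ, and Dw(x,0) = 0 for all x ∈ ℝ. -/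
open MeasureTheory Real intervalIntegral

open scoped FourierTransform LineDeriv SchwartzMap ContDiff

namespace Kawahara

/-- The Fourier transform of `w` in the first variable, with the kernel `e^{-iyξ}`. -/
noncomputable def spaceFourier (w : 𝓢(ℝ × ℝ, ℂ)) (ξ t : ℝ) : ℂ :=
  ∫ y : ℝ, Complex.exp (-(Complex.I * ((y * ξ : ℝ) : ℂ))) * w (y, t)

/-- The contribution of the frequency `ξ` to the Duhamel integral. -/
noncomputable def duhamelMode (w : 𝓢(ℝ × ℝ, ℂ)) (p : ℝ × ℝ) (ξ : ℝ) : ℂ :=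
  ∫ s in (0 : ℝ)..p.2,
    Complex.exp (Complex.I * ((p.1 * ξ + (p.2 - s) * ξ ^ 5 : ℝ) : ℂ)) * spaceFourier w ξ s

/-- The Duhamel operator, with the frequency integral outermost. -/
noncomputable def duhamel (w : 𝓢(ℝ × ℝ, ℂ)) (p : ℝ × ℝ) : ℂ :=
  ((2 * π : ℝ) : ℂ)⁻¹ * ∫ ξ : ℝ, duhamelMode w p ξ

/-- The derivative in the first variable. -/
noncomputable def dx (w : 𝓢(ℝ × ℝ, ℂ)) : 𝓢(ℝ × ℝ, ℂ) := ∂_{((1, 0) : ℝ × ℝ)} w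

lemma norm_exp_I_mul (a : ℝ) : ‖Complex.exp (Complex.I * (a : ℂ))‖ = 1 := by
  rw [mul_comm, Complex.norm_exp_ofReal_mul_I]

lemma norm_exp_neg_I_mul (a : ℝ) : ‖Complex.exp (-(Complex.I * (a : ℂ)))‖ = 1 := by
  simpa using norm_exp_I_mul (-a)

lemma hasDerivAt_slice (w : 𝓢(ℝ × ℝ, ℂ)) (y t : ℝ) :
    HasDerivAt (fun y => w (y, t)) (dx w (y, t)) y := by
  have h : HasDerivAt (fun y : ℝ => (y, t)) ((1, 0) : ℝ × ℝ) y :=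
    (hasDerivAt_id y).prodMk (hasDerivAt_const y t)
  simpa [dx, SchwartzMap.lineDerivOp_apply_eq_fderiv, Function.comp_def] using
    (w.differentiable (y, t)).hasFDerivAt.comp_hasDerivAt y h

lemma exists_slice_bound (w : 𝓢(ℝ × ℝ, ℂ)) :
    ∃ C : ℝ, ∀ y t : ℝ, ‖w (y, t)‖ ≤ C * (1 + y ^ 2)⁻¹ := by
  obtain ⟨C₀, -, h₀⟩ := w.decay 0 0
  obtain ⟨C₂, -, h₂⟩ := w.decay 2 0
  refine ⟨C₀ + C₂, fun y t => ?_⟩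
  rw [← div_eq_mul_inv, le_div_iff₀ (by positivity)]
  have e₀ := h₀ (y, t)
  have e₂ := h₂ (y, t)
  simp only [norm_iteratedFDeriv_zero, pow_zero, one_mul] at e₀ e₂
  have hy : y ^ 2 ≤ ‖(y, t)‖ ^ 2 := by
    rw [← sq_abs]
    gcongr
    exact norm_fst_le (y, t)
  nlinarith [mul_le_mul_of_nonneg_right hy (norm_nonneg (w (y, t)))]

lemma integrable_slice (w : 𝓢(ℝ × ℝ, ℂ)) (t : ℝ) : Integrable (fun y => w (y, t)) := by
  obtain ⟨C, hC⟩ := exists_slice_bound w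
  refine (integrable_inv_one_add_sq.const_mul C).mono' ?_ (.of_forall fun y => hC y t)
  exact (w.continuous.comp (by fun_prop)).aestronglyMeasurable

lemma fourier_slice (w : 𝓢(ℝ × ℝ, ℂ)) (η t : ℝ) :
    𝓕 (fun y => w (y, t)) η = spaceFourier w (2 * π * η) t := by
  rw [Real.fourier_real_eq_integral_exp_smul, spaceFourier]
  congr 1 with y
  rw [smul_eq_mul]
  congr 2
  push_cast
  ring

lemma spaceFourier_eq_fourier (w : 𝓢(ℝ × ℝ, ℂ)) (ξ t : ℝ) :
    spaceFourier w ξ t = 𝓕 (fun y => w (y, t)) (ξ / (2 * π)) := by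
  rw [fourier_slice]
  congr 1
  field_simp

lemma spaceFourier_dx (w : 𝓢(ℝ × ℝ, ℂ)) (ξ t : ℝ) :
    spaceFourier (dx w) ξ t = Complex.I * ξ * spaceFourier w ξ t := by
  have hd : deriv (fun y => w (y, t)) = fun y => dx w (y, t) :=
    funext fun y => (hasDerivAt_slice w y t).deriv
  have h := congrFun (Real.fourier_deriv (integrable_slice w t)
    (fun y => (hasDerivAt_slice w y t).differentiableAt)
    (hd ▸ integrable_slice (dx w) t)) (ξ / (2 * π))
  rw [hd] at h
  rw [spaceFourier_eq_fourier, spaceFourier_eq_fourier, h, smul_eq_mul]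
  have : (π : ℂ) ≠ 0 := by exact_mod_cast pi_ne_zero
  push_cast
  field_simp

lemma spaceFourier_dx_iterate_five (w : 𝓢(ℝ × ℝ, ℂ)) (ξ t : ℝ) :
    spaceFourier (dx^[5] w) ξ t = Complex.I * (ξ : ℂ) ^ 5 * spaceFourier w ξ t := by
  simp only [Function.iterate_succ, Function.iterate_zero, Function.comp_apply, id_eq,
    spaceFourier_dx]
  linear_combination (Complex.I * (ξ : ℂ) ^ 5 * spaceFourier w ξ t * (Complex.I ^ 2 - 1)) *
    Complex.I_sq

lemma continuous_spaceFourier (w : 𝓢(ℝ × ℝ, ℂ)) :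
    Continuous fun p : ℝ × ℝ => spaceFourier w p.1 p.2 := by
  obtain ⟨C, hC⟩ := exists_slice_bound w
  have hw := w.continuous
  refine continuous_of_dominated (bound := fun y => C * (1 + y ^ 2)⁻¹)
    (fun p => ?_) (fun p => .of_forall fun y => ?_)
    (integrable_inv_one_add_sq.const_mul C) (.of_forall fun y => ?_)
  · exact Continuous.aestronglyMeasurable (by fun_prop)
  · rw [norm_mul, norm_exp_neg_I_mul, one_mul]
    exact hC y p.2
  · fun_prop

lemma exists_spaceFourier_bound (w : 𝓢(ℝ × ℝ, ℂ)) :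
    ∃ C : ℝ, ∀ ξ t : ℝ, ‖spaceFourier w ξ t‖ ≤ C * (1 + ξ ^ 2)⁻¹ := by
  have key (w : 𝓢(ℝ × ℝ, ℂ)) : ∃ C : ℝ, ∀ ξ t : ℝ, ‖spaceFourier w ξ t‖ ≤ C := by
    obtain ⟨C, hC⟩ := exists_slice_bound w
    refine ⟨∫ y : ℝ, C * (1 + y ^ 2)⁻¹, fun ξ t => ?_⟩
    refine norm_integral_le_of_norm_le (integrable_inv_one_add_sq.const_mul C)
      (.of_forall fun y => ?_)
    rw [norm_mul, norm_exp_neg_I_mul, one_mul]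
    exact hC y t
  obtain ⟨C₀, h₀⟩ := key w
  obtain ⟨C₂, h₂⟩ := key (dx (dx w))
  refine ⟨C₀ + C₂, fun ξ t => ?_⟩
  rw [← div_eq_mul_inv, le_div_iff₀ (by positivity)]
  have e₀ := h₀ ξ t
  have e₂ := h₂ ξ t
  simp only [spaceFourier_dx, norm_mul, Complex.norm_I, one_mul, Complex.norm_real,
    norm_eq_abs] at e₂
  rw [← mul_assoc, abs_mul_abs_self] at e₂
  linarith

lemma integrable_spaceFourier (w : 𝓢(ℝ × ℝ, ℂ)) (t : ℝ) :
    Integrable fun ξ => spaceFourier w ξ t := by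
  obtain ⟨C, hC⟩ := exists_spaceFourier_bound w
  refine (integrable_inv_one_add_sq.const_mul C).mono' ?_ (.of_forall fun ξ => hC ξ t)
  exact ((continuous_spaceFourier w).comp (by fun_prop :
    Continuous fun ξ : ℝ => (ξ, t))).aestronglyMeasurable

lemma spaceFourier_inversion (w : 𝓢(ℝ × ℝ, ℂ)) (x t : ℝ) :
    ((2 * π : ℝ) : ℂ)⁻¹ *
      ∫ ξ : ℝ, Complex.exp (Complex.I * ((x * ξ : ℝ) : ℂ)) * spaceFourier w ξ t = w (x, t) := by
  have hcont : Continuous fun y => w (y, t) := w.continuous.comp (by fun_prop)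
  have hint : Integrable (𝓕 fun y => w (y, t)) := by
    rw [show (𝓕 fun y => w (y, t)) = fun η => spaceFourier w (2 * π * η) t from
      funext fun η => fourier_slice w η t]
    exact (integrable_spaceFourier w t).comp_mul_left' (by positivity)
  have h := congrFun (hcont.fourierInv_fourier_eq (integrable_slice w t) hint) x
  rw [Real.fourierInv_eq'] at h
  rw [← h]
  have hs := Measure.integral_comp_mul_left
    (fun ξ : ℝ => Complex.exp (Complex.I * ((x * ξ : ℝ) : ℂ)) * spaceFourier w ξ t) (2 * π)
  rw [abs_of_pos (by positivity), Complex.real_smul, Complex.ofReal_inv] at hs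
  rw [← hs]
  congr 1 with η
  rw [fourier_slice, smul_eq_mul]
  congr 2
  simp
  ring

lemma continuous_duhamelMode_integrand (w : 𝓢(ℝ × ℝ, ℂ)) (p : ℝ × ℝ) :
    Continuous fun q : ℝ × ℝ =>
      Complex.exp (Complex.I * ((p.1 * q.1 + (p.2 - q.2) * q.1 ^ 5 : ℝ) : ℂ)) *
        spaceFourier w q.1 q.2 := by
  have := continuous_spaceFourier w
  fun_prop

lemma continuous_duhamelMode (w : 𝓢(ℝ × ℝ, ℂ)) (p : ℝ × ℝ) : Continuous (duhamelMode w p) :=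
  continuous_parametric_intervalIntegral_of_continuous
    (f := fun ξ s => Complex.exp (Complex.I * ((p.1 * ξ + (p.2 - s) * ξ ^ 5 : ℝ) : ℂ)) *
      spaceFourier w ξ s) (continuous_duhamelMode_integrand w p) continuous_const

lemma exists_duhamelMode_bound (w : 𝓢(ℝ × ℝ, ℂ)) :
    ∃ C : ℝ, ∀ p ξ, ‖duhamelMode w p ξ‖ ≤ |p.2| * (C * (1 + ξ ^ 2)⁻¹) := by
  obtain ⟨C, hC⟩ := exists_spaceFourier_bound w
  refine ⟨C, fun p ξ => ?_⟩
  have := norm_integral_le_of_norm_le_const (a := 0) (b := p.2) (C := C * (1 + ξ ^ 2)⁻¹)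
    (f := fun s => Complex.exp (Complex.I * ((p.1 * ξ + (p.2 - s) * ξ ^ 5 : ℝ) : ℂ)) *
      spaceFourier w ξ s) fun s _ => by
        rw [norm_mul, norm_exp_I_mul, one_mul]
        exact hC ξ s
  rwa [sub_zero, mul_comm (C * _)] at this

lemma integrable_duhamelMode (w : 𝓢(ℝ × ℝ, ℂ)) (p : ℝ × ℝ) : Integrable (duhamelMode w p) := by
  obtain ⟨C, hC⟩ := exists_duhamelMode_bound w
  exact ((integrable_inv_one_add_sq.const_mul C).const_mul |p.2|).mono'
    (continuous_duhamelMode w p).aestronglyMeasurable (.of_forall fun ξ => hC p ξ)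

/-- The derivative with prescribed partial derivatives `a` and `b`. -/
noncomputable def ofPartials (a b : ℂ) : ℝ × ℝ →L[ℝ] ℂ :=
  (ContinuousLinearMap.fst ℝ ℝ ℝ).smulRight a + (ContinuousLinearMap.snd ℝ ℝ ℝ).smulRight b

lemma norm_ofPartials_le (a b : ℂ) : ‖ofPartials a b‖ ≤ ‖a‖ + ‖b‖ := by
  refine (norm_add_le _ _).trans ?_
  rw [ContinuousLinearMap.norm_smulRight_apply, ContinuousLinearMap.norm_smulRight_apply]
  have h₁ := ContinuousLinearMap.norm_fst_le ℝ ℝ ℝ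
  have h₂ := ContinuousLinearMap.norm_snd_le ℝ ℝ ℝ
  nlinarith [norm_nonneg a, norm_nonneg b]

lemma duhamelMode_eq (w : 𝓢(ℝ × ℝ, ℂ)) (p : ℝ × ℝ) (ξ : ℝ) :
    duhamelMode w p ξ = Complex.exp (Complex.I * ((p.1 : ℂ) * ξ + p.2 * (ξ : ℂ) ^ 5)) *
      ∫ s in (0 : ℝ)..p.2,
        Complex.exp (-(Complex.I * (s * (ξ : ℂ) ^ 5))) * spaceFourier w ξ s := by
  rw [duhamelMode, ← intervalIntegral.integral_const_mul]
  congr 1 with s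
  rw [← mul_assoc, ← Complex.exp_add]
  congr 2
  push_cast
  ring

lemma hasFDerivAt_duhamelMode (w : 𝓢(ℝ × ℝ, ℂ)) (p : ℝ × ℝ) (ξ : ℝ) :
    HasFDerivAt (fun p => duhamelMode w p ξ)
      (ofPartials (duhamelMode (dx w) p ξ)
        (Complex.exp (Complex.I * ((p.1 * ξ : ℝ) : ℂ)) * spaceFourier w ξ p.2 +
          duhamelMode (dx^[5] w) p ξ)) p := by
  have hc : Continuous fun s : ℝ =>
      Complex.exp (-(Complex.I * (s * (ξ : ℂ) ^ 5))) * spaceFourier w ξ s := by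
    have := (continuous_spaceFourier w).comp (by fun_prop : Continuous fun s : ℝ => (ξ, s))
    simp only [Function.comp_def] at this
    fun_prop
  have hB := (integral_hasDerivAt_right (hc.intervalIntegrable 0 p.2)
    (hc.stronglyMeasurableAtFilter _ _) hc.continuousAt).hasFDerivAt.comp p
      (hasFDerivAt_snd (𝕜 := ℝ) (p := p))
  have h1 : HasFDerivAt (fun p : ℝ × ℝ => (p.1 : ℂ))
      (Complex.ofRealCLM.comp (ContinuousLinearMap.fst ℝ ℝ ℝ)) p :=
    (Complex.ofRealCLM.comp (ContinuousLinearMap.fst ℝ ℝ ℝ)).hasFDerivAt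
  have h2 : HasFDerivAt (fun p : ℝ × ℝ => (p.2 : ℂ))
      (Complex.ofRealCLM.comp (ContinuousLinearMap.snd ℝ ℝ ℝ)) p :=
    (Complex.ofRealCLM.comp (ContinuousLinearMap.snd ℝ ℝ ℝ)).hasFDerivAt
  have hA := (((h1.mul_const (ξ : ℂ)).add (h2.mul_const ((ξ : ℂ) ^ 5))).const_mul
    Complex.I).cexp
  have h := hA.mul hB
  simp only [duhamelMode_eq, spaceFourier_dx, spaceFourier_dx_iterate_five]
  refine h.congr_fderiv ?_
  have e : Complex.exp (Complex.I * ((p.1 * ξ : ℝ) : ℂ)) =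
      Complex.exp (Complex.I * ((p.1 : ℂ) * ξ + p.2 * (ξ : ℂ) ^ 5)) *
        Complex.exp (-(Complex.I * (p.2 * (ξ : ℂ) ^ 5))) := by
    rw [← Complex.exp_add]
    congr 1
    push_cast
    ring
  have m (c : ℂ) : (∫ s in (0 : ℝ)..p.2, Complex.exp (-(Complex.I * (s * (ξ : ℂ) ^ 5))) *
      (c * spaceFourier w ξ s)) = c * ∫ s in (0 : ℝ)..p.2,
        Complex.exp (-(Complex.I * (s * (ξ : ℂ) ^ 5))) * spaceFourier w ξ s := by
    rw [← intervalIntegral.integral_const_mul]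
    congr 1 with s
    ring
  rw [e, m, m]
  ext <;> simp [ofPartials] <;> ring

/-- The derivative of `duhamelMode w` in the space-time variable. -/
noncomputable def duhamelModeFDeriv (w : 𝓢(ℝ × ℝ, ℂ)) (p : ℝ × ℝ) (ξ : ℝ) : ℝ × ℝ →L[ℝ] ℂ :=
  ofPartials (duhamelMode (dx w) p ξ)
    (Complex.exp (Complex.I * ((p.1 * ξ : ℝ) : ℂ)) * spaceFourier w ξ p.2 +
      duhamelMode (dx^[5] w) p ξ)

lemma continuous_exp_mul_spaceFourier (w : 𝓢(ℝ × ℝ, ℂ)) (x t : ℝ) :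
    Continuous fun ξ : ℝ =>
      Complex.exp (Complex.I * ((x * ξ : ℝ) : ℂ)) * spaceFourier w ξ t := by
  have := (continuous_spaceFourier w).comp (by fun_prop : Continuous fun ξ : ℝ => (ξ, t))
  simp only [Function.comp_def] at this
  fun_prop

lemma integrable_exp_mul_spaceFourier (w : 𝓢(ℝ × ℝ, ℂ)) (x t : ℝ) :
    Integrable fun ξ : ℝ =>
      Complex.exp (Complex.I * ((x * ξ : ℝ) : ℂ)) * spaceFourier w ξ t := by
  refine (integrable_spaceFourier w t).norm.mono'
    (continuous_exp_mul_spaceFourier w x t).aestronglyMeasurable (.of_forall fun ξ => ?_)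
  rw [norm_mul, norm_exp_I_mul, one_mul]

lemma continuous_duhamelModeFDeriv (w : 𝓢(ℝ × ℝ, ℂ)) (p : ℝ × ℝ) :
    Continuous (duhamelModeFDeriv w p) := by
  have c₀ := continuous_exp_mul_spaceFourier w p.1 p.2
  have c₁ := continuous_duhamelMode (dx w) p
  have c₅ := continuous_duhamelMode (dx^[5] w) p
  unfold duhamelModeFDeriv ofPartials
  fun_prop

lemma exists_duhamelModeFDeriv_bound (w : 𝓢(ℝ × ℝ, ℂ)) :
    ∃ C : ℝ, 0 ≤ C ∧
      ∀ p ξ, ‖duhamelModeFDeriv w p ξ‖ ≤ (1 + |p.2|) * (C * (1 + ξ ^ 2)⁻¹) := by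
  obtain ⟨C₀, h₀⟩ := exists_spaceFourier_bound w
  obtain ⟨C₁, h₁⟩ := exists_duhamelMode_bound (dx w)
  obtain ⟨C₅, h₅⟩ := exists_duhamelMode_bound (dx^[5] w)
  have n₀ : 0 ≤ C₀ := by simpa using (norm_nonneg _).trans (h₀ 0 0)
  have n₁ : 0 ≤ C₁ := by simpa using (norm_nonneg _).trans (h₁ (0, 1) 0)
  have n₅ : 0 ≤ C₅ := by simpa using (norm_nonneg _).trans (h₅ (0, 1) 0)
  refine ⟨C₀ + C₁ + C₅, by positivity, fun p ξ => ?_⟩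
  have e := norm_add_le (Complex.exp (Complex.I * ((p.1 * ξ : ℝ) : ℂ)) * spaceFourier w ξ p.2)
    (duhamelMode (dx^[5] w) p ξ)
  rw [norm_mul, norm_exp_I_mul, one_mul] at e
  have k : (0 : ℝ) ≤ (1 + ξ ^ 2)⁻¹ := by positivity
  calc ‖duhamelModeFDeriv w p ξ‖
      ≤ |p.2| * (C₁ * (1 + ξ ^ 2)⁻¹) +
          (C₀ * (1 + ξ ^ 2)⁻¹ + |p.2| * (C₅ * (1 + ξ ^ 2)⁻¹)) :=
        (norm_ofPartials_le _ _).trans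
          (add_le_add (h₁ p ξ) (e.trans (add_le_add (h₀ ξ p.2) (h₅ p ξ))))
    _ ≤ (1 + |p.2|) * ((C₀ + C₁ + C₅) * (1 + ξ ^ 2)⁻¹) := by
        nlinarith [mul_nonneg n₁ k, mul_nonneg n₅ k,
          mul_nonneg (abs_nonneg p.2) (mul_nonneg n₀ k)]

lemma integrable_duhamelModeFDeriv (w : 𝓢(ℝ × ℝ, ℂ)) (p : ℝ × ℝ) :
    Integrable (duhamelModeFDeriv w p) := by
  obtain ⟨C, -, hC⟩ := exists_duhamelModeFDeriv_bound w
  exact ((integrable_inv_one_add_sq.const_mul C).const_mul (1 + |p.2|)).mono'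
    (continuous_duhamelModeFDeriv w p).aestronglyMeasurable (.of_forall fun ξ => hC p ξ)

lemma integral_duhamelModeFDeriv (w : 𝓢(ℝ × ℝ, ℂ)) (p : ℝ × ℝ) :
    ((2 * π : ℝ) : ℂ)⁻¹ • ∫ ξ, duhamelModeFDeriv w p ξ =
      ofPartials (duhamel (dx w) p) (w p + duhamel (dx^[5] w) p) := by
  have key (v : ℝ × ℝ) : (∫ ξ, duhamelModeFDeriv w p ξ) v =
      v.1 * (∫ ξ, duhamelMode (dx w) p ξ) +
        v.2 * ((∫ ξ : ℝ, Complex.exp (Complex.I * ((p.1 * ξ : ℝ) : ℂ)) *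
          spaceFourier w ξ p.2) + ∫ ξ, duhamelMode (dx^[5] w) p ξ) := by
    have i₀ := integrable_exp_mul_spaceFourier w p.1 p.2
    have i₁ := integrable_duhamelMode (dx w) p
    have i₅ := integrable_duhamelMode (dx^[5] w) p
    rw [ContinuousLinearMap.integral_apply (integrable_duhamelModeFDeriv w p),
      ← integral_add i₀ i₅, ← MeasureTheory.integral_const_mul,
      ← MeasureTheory.integral_const_mul]
    exact integral_add (i₁.const_mul _) ((i₀.add i₅).const_mul _)
  refine ContinuousLinearMap.ext fun v => ?_
  rw [_root_.smul_apply, key, ← spaceFourier_inversion w p.1 p.2]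
  simp only [ofPartials, duhamel, _root_.add_apply,
    ContinuousLinearMap.smulRight_apply, ContinuousLinearMap.coe_fst',
    ContinuousLinearMap.coe_snd', Complex.real_smul, smul_eq_mul]
  ring

lemma hasFDerivAt_duhamel (w : 𝓢(ℝ × ℝ, ℂ)) (p : ℝ × ℝ) :
    HasFDerivAt (duhamel w) (ofPartials (duhamel (dx w) p) (w p + duhamel (dx^[5] w) p)) p := by
  obtain ⟨C, hC₀, hC⟩ := exists_duhamelModeFDeriv_bound w
  rw [← integral_duhamelModeFDeriv]
  refine HasFDerivAt.const_mul (hasFDerivAt_integral_of_dominated_of_fderiv_le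
    (bound := fun ξ => (2 + |p.2|) * (C * (1 + ξ ^ 2)⁻¹)) (Metric.ball_mem_nhds p one_pos)
    (.of_forall fun q => (continuous_duhamelMode w q).aestronglyMeasurable)
    (integrable_duhamelMode w p) (continuous_duhamelModeFDeriv w p).aestronglyMeasurable
    (.of_forall fun ξ q hq => (hC q ξ).trans ?_)
    ((integrable_inv_one_add_sq.const_mul C).const_mul _)
    (.of_forall fun ξ q _ => hasFDerivAt_duhamelMode w q ξ)) _
  have h : |q.2 - p.2| ≤ 1 := (norm_snd_le (q - p)).trans (mem_ball_iff_norm.1 hq).le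
  have := abs_sub_abs_le_abs_sub q.2 p.2
  gcongr ?_ * _
  linarith

lemma contDiff_duhamel (n : ℕ) (w : 𝓢(ℝ × ℝ, ℂ)) : ContDiff ℝ n (duhamel w) := by
  induction n generalizing w with
  | zero =>
    exact contDiff_zero.2 (continuous_iff_continuousAt.2 fun p =>
      (hasFDerivAt_duhamel w p).continuousAt)
  | succ n ih =>
    refine contDiff_succ_iff_hasFDerivAt.2 ⟨_, ?_, hasFDerivAt_duhamel w⟩
    unfold ofPartials
    have h₁ := ih (dx w)
    have h₅ := ih (dx^[5] w)
    have hw := w.smooth n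
    fun_prop

lemma hasDerivAt_duhamel_fst (w : 𝓢(ℝ × ℝ, ℂ)) (x t : ℝ) :
    HasDerivAt (fun y => duhamel w (y, t)) (duhamel (dx w) (x, t)) x := by
  have h : HasDerivAt (fun y : ℝ => (y, t)) ((1, 0) : ℝ × ℝ) x :=
    (hasDerivAt_id x).prodMk (hasDerivAt_const x t)
  simpa [ofPartials, Function.comp_def] using (hasFDerivAt_duhamel w (x, t)).comp_hasDerivAt x h

lemma hasDerivAt_duhamel_snd (w : 𝓢(ℝ × ℝ, ℂ)) (x t : ℝ) :
    HasDerivAt (fun s => duhamel w (x, s)) (w (x, t) + duhamel (dx^[5] w) (x, t)) t := by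
  have h : HasDerivAt (fun s : ℝ => (x, s)) ((0, 1) : ℝ × ℝ) t :=
    (hasDerivAt_const t x).prodMk (hasDerivAt_id t)
  simpa [ofPartials, Function.comp_def] using (hasFDerivAt_duhamel w (x, t)).comp_hasDerivAt t h

lemma iteratedDeriv_duhamel_fst (n : ℕ) (w : 𝓢(ℝ × ℝ, ℂ)) (t : ℝ) :
    iteratedDeriv n (fun y => duhamel w (y, t)) = fun y => duhamel (dx^[n] w) (y, t) := by
  induction n generalizing w with
  | zero => simp
  | succ n ih =>
    rw [iteratedDeriv_succ', Function.iterate_succ_apply, ← ih]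
    congr 1
    exact funext fun y => (hasDerivAt_duhamel_fst w y t).deriv

lemma duhamel_eq_integral (w : 𝓢(ℝ × ℝ, ℂ)) (x t : ℝ) :
    duhamel w (x, t) = ∫ t' in (0 : ℝ)..t, ((2 * π : ℝ) : ℂ)⁻¹ *
      ∫ ξ : ℝ, Complex.exp (Complex.I * ((x * ξ + (t - t') * ξ ^ 5 : ℝ) : ℂ)) *
        spaceFourier w ξ t' := by
  obtain ⟨C, hC⟩ := exists_spaceFourier_bound w
  rw [intervalIntegral.integral_const_mul, duhamel, intervalIntegral_integral_swap]
  · rfl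
  have : IsFiniteMeasure (volume.restrict (Set.uIoc 0 t)) := by
    unfold Set.uIoc
    infer_instance
  have hb : Integrable (fun q : ℝ × ℝ => (1 : ℝ) * (C * (1 + q.2 ^ 2)⁻¹))
      ((volume.restrict (Set.uIoc 0 t)).prod volume) :=
    Integrable.mul_prod (f := fun _ => (1 : ℝ)) (integrable_const _)
      (integrable_inv_one_add_sq.const_mul C)
  refine hb.mono' ((continuous_duhamelMode_integrand w (x, t)).comp
    continuous_swap).aestronglyMeasurable (.of_forall fun q => ?_)
  simp only [Function.uncurry]
  rw [norm_mul, norm_exp_I_mul, one_mul, one_mul]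
  exact hC q.2 q.1

end Kawahara

/-- The Duhamel inhomogeneous solution operator
`Dw(x,t) = ∫₀ᵗ e^{(t-t')∂ₓ⁵} w(t',x) dt'` of the linearized Kawahara equation:
it is smooth, solves `∂ₜ Dw - ∂ₓ⁵ Dw = w` and vanishes at `t = 0`. -/
theorem kawahara_duhamel_operator (w : SchwartzMap (ℝ × ℝ) ℂ)
    (what : ℝ → ℝ → ℂ)
    (hwhat : ∀ ξ t' : ℝ,
      what ξ t' = ∫ y : ℝ, Complex.exp (-(Complex.I * ((y * ξ : ℝ) : ℂ))) * w (y, t'))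
    (Dw : ℝ → ℝ → ℂ)
    (hDw : ∀ x t : ℝ, Dw x t
      = ∫ t' in (0:ℝ)..t, ((2 * Real.pi : ℝ) : ℂ)⁻¹
          * ∫ ξ : ℝ,
              Complex.exp (Complex.I * ((x * ξ + (t - t') * ξ ^ 5 : ℝ) : ℂ)) * what ξ t') :
    ContDiff ℝ (⊤ : ℕ∞) (fun p : ℝ × ℝ => Dw p.1 p.2)
      ∧ (∀ x t : ℝ,
          deriv (fun s => Dw x s) t - iteratedDeriv 5 (fun y => Dw y t) x = w (x, t))
      ∧ ∀ x : ℝ, Dw x 0 = 0 := by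
  obtain rfl : what = Kawahara.spaceFourier w := funext₂ hwhat
  obtain rfl : Dw = fun x t => Kawahara.duhamel w (x, t) :=
    funext₂ fun x t => (hDw x t).trans (Kawahara.duhamel_eq_integral w x t).symm
  refine ⟨contDiff_infty.2 fun n => Kawahara.contDiff_duhamel n w, fun x t => ?_, fun x => ?_⟩
  · rw [(Kawahara.hasDerivAt_duhamel_snd w x t).deriv, Kawahara.iteratedDeriv_duhamel_fst,
      add_sub_cancel_right]
  · simp [hDw x 0]
end
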